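/- arXiv:1302.2570 — 2 statements merged into one kernel-verified Lean document; each statement's English description precedes it below -/
import Mathlib

section
/- In a cycle on n vertices with n ≥ 2r + 2, the ball of radius r around any vertex induces a path: for every vertex v of the cycle graph on n vertices, the set S = {w | dist(v, w) ≤ r} (graph distance in the cycle) has exactly 2r + 1 elements, and the subgraph of the cycle induced on S is isomorphic to the path graph on 2r + 1 vertices. -/
theorem Fin.val_sub_eq_ite {n : ℕ} (a b : Fin n) :
    (a - b).val = if b.val ≤ a.val then a.val - b.val else n + a.val - b.val := by
  split_ifs with h
  · exact Fin.sub_val_of_le h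
  · rw [Fin.val_sub, Nat.mod_eq_of_lt (by omega)]
    omega

theorem SimpleGraph.Walk.min_val_sub_le_length {n : ℕ} {u w : Fin n}
    (p : (SimpleGraph.cycleGraph n).Walk u w) :
    min (w - u).val (u - w).val ≤ p.length := by
  induction p with
  | nil => simp [Fin.val_sub_eq_ite]
  | @cons a b c h p ih =>
    rw [SimpleGraph.cycleGraph_adj'] at h
    simp only [SimpleGraph.Walk.length_cons, Fin.val_sub_eq_ite] at *
    have := a.isLt
    have := b.isLt
    have := c.isLt
    split_ifs at * <;> omega

theorem SimpleGraph.cycleGraph_dist_le_val_sub {n : ℕ} (u w : Fin n) :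
    (SimpleGraph.cycleGraph n).dist u w ≤ (w - u).val := by
  induction hk : (w - u).val generalizing u with
  | zero =>
    obtain rfl : u = w := by
      rw [Fin.val_sub_eq_ite] at hk
      split_ifs at hk <;> omega
    simp
  | succ k ih =>
    obtain ⟨x, hx⟩ : ∃ x : Fin n, x.val = if u.val + 1 < n then u.val + 1 else 0 :=
      ⟨⟨if u.val + 1 < n then u.val + 1 else 0, by split_ifs <;> omega⟩, rfl⟩
    have hxw : (w - x).val = k := by
      rw [Fin.val_sub_eq_ite] at hk ⊢
      split_ifs at * <;> omega
    have hadj : (SimpleGraph.cycleGraph n).Adj u x := by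
      rw [SimpleGraph.cycleGraph_adj']
      right
      rw [Fin.val_sub_eq_ite] at hk ⊢
      split_ifs at * <;> omega
    obtain ⟨p, hp⟩ :=
      (SimpleGraph.cycleGraph_preconnected x w).exists_walk_length_eq_dist
    have h := SimpleGraph.dist_le (SimpleGraph.Walk.cons hadj p)
    rw [SimpleGraph.Walk.length_cons, hp] at h
    have := ih x hxw
    omega

theorem SimpleGraph.cycleGraph_dist {n : ℕ} (u w : Fin n) :
    (SimpleGraph.cycleGraph n).dist u w = min (w - u).val (u - w).val := by
  apply le_antisymm
  · refine le_min (cycleGraph_dist_le_val_sub u w) ?_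
    rw [SimpleGraph.dist_comm]
    exact cycleGraph_dist_le_val_sub w u
  · obtain ⟨p, hp⟩ :=
      (SimpleGraph.cycleGraph_preconnected u w).exists_walk_length_eq_dist
    exact hp ▸ p.min_val_sub_le_length

/-- In a cycle on `n ≥ 2r + 2` vertices, the radius-`r` ball around any vertex `v` has
exactly `2r + 1` elements, and the subgraph of the cycle induced on this ball is
isomorphic to the path graph on `2r + 1` vertices. -/
theorem cycle_ball_induces_path (n r : ℕ) (hn : 2 * r + 2 ≤ n) (v : Fin n) :
    Nat.card {w : Fin n | (SimpleGraph.cycleGraph n).dist v w ≤ r} = 2 * r + 1 ∧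
    Nonempty
      (SimpleGraph.induce {w : Fin n | (SimpleGraph.cycleGraph n).dist v w ≤ r}
          (SimpleGraph.cycleGraph n) ≃g
        SimpleGraph.pathGraph (2 * r + 1)) := by
  suffices h : Nonempty
      (SimpleGraph.induce {w : Fin n | (SimpleGraph.cycleGraph n).dist v w ≤ r}
          (SimpleGraph.cycleGraph n) ≃g
        SimpleGraph.pathGraph (2 * r + 1)) by
    obtain ⟨e⟩ := h
    exact ⟨by rw [Nat.card_congr e.toEquiv, Nat.card_fin], ⟨e⟩⟩
  have hshift (i : Fin (2 * r + 1)) : ∃ w : Fin n, w.val =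
      if v.val + i < r then v.val + i + n - r
      else if v.val + i - r < n then v.val + i - r else v.val + i - r - n :=
    ⟨⟨if v.val + i < r then v.val + i + n - r
      else if v.val + i - r < n then v.val + i - r else v.val + i - r - n,
      by split_ifs <;> omega⟩, rfl⟩
  choose f hf using hshift
  have hmem (i) : (SimpleGraph.cycleGraph n).dist v (f i) ≤ r := by
    have := hf i
    simp only [SimpleGraph.cycleGraph_dist, Fin.val_sub_eq_ite]
    split_ifs at * <;> omega
  have hinj : Function.Injective f := by
    intro i j hij
    have hi := hf i
    have hj := hf j
    rw [hij] at hi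
    ext
    split_ifs at * <;> omega
  have hsurj (w : Fin n) (hw : (SimpleGraph.cycleGraph n).dist v w ≤ r) : ∃ i, f i = w := by
    simp only [SimpleGraph.cycleGraph_dist, Fin.val_sub_eq_ite] at hw
    obtain ⟨i, hi⟩ : ∃ i : Fin (2 * r + 1), w.val + r = v.val + i ∨
        w.val + r = v.val + i + n ∨ w.val + r + n = v.val + i := by
      by_cases h₁ : v.val ≤ w.val + r ∧ w.val + r - v.val < 2 * r + 1
      · exact ⟨⟨w.val + r - v.val, h₁.2⟩, by simp only; omega⟩
      by_cases h₂ : w.val + r < v.val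
      · exact ⟨⟨w.val + r + n - v.val, by split_ifs at * <;> omega⟩, by simp only; omega⟩
      · refine ⟨⟨w.val + r - v.val - n, by split_ifs at * <;> omega⟩, ?_⟩
        simp only
        split_ifs at * <;> omega
    refine ⟨i, ?_⟩
    have := hf i
    ext
    split_ifs at * <;> omega
  let e : Fin (2 * r + 1) ≃ {w : Fin n | (SimpleGraph.cycleGraph n).dist v w ≤ r} :=
    Equiv.ofBijective (fun i => ⟨f i, hmem i⟩)
      ⟨fun i j h => hinj (congrArg Subtype.val h),
        fun w => (hsurj w.1 w.2).imp fun i h => Subtype.ext h⟩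
  refine ⟨(RelIso.symm ⟨e, ?_⟩)⟩
  intro i j
  change (SimpleGraph.cycleGraph n).Adj (f i) (f j) ↔ _
  have hi := hf i
  have hj := hf j
  rw [SimpleGraph.cycleGraph_adj', SimpleGraph.pathGraph_adj, Fin.val_sub_eq_ite,
    Fin.val_sub_eq_ite]
  split_ifs at * <;> omega
end

section
/- Large cycles of different sizes are locally indistinguishable: for all n, m ≥ 2r + 2 and any vertices v in the cycle graph on n vertices and u in the cycle graph on m vertices, the subgraph of the n-cycle induced on the radius-r ball {w | dist(v, w) ≤ r} is isomorphic to the subgraph of the m-cycle induced on the radius-r ball {w | dist(u, w) ≤ r}. -/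
namespace SimpleGraph

theorem cycleGraph_adj_iff_dvd {n : ℕ} (hn : 2 ≤ n) (v w : Fin n) :
    (cycleGraph n).Adj v w ↔
      (n : ℤ) ∣ (w : ℤ) - v - 1 ∨ (n : ℤ) ∣ (w : ℤ) - v + 1 := by
  have hv := v.isLt
  have hw := w.isLt
  have key : ∀ a : ℤ, -2 * n < a → a < 2 * n →
      ((n : ℤ) ∣ a ↔ a = 0 ∨ a = n ∨ a = -n) := by
    intro a h₁ h₂
    constructor
    · rintro ⟨c, rfl⟩
      have h₃ : -2 < c := by nlinarith
      have h₄ : c < 2 := by nlinarith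
      interval_cases c <;> simp
    · rintro (rfl | rfl | rfl) <;> simp
  rw [cycleGraph_adj', key _ (by omega) (by omega), key _ (by omega) (by omega),
    Fin.val_sub, Fin.val_sub]
  have mod_eq : ∀ a : ℕ, a < 2 * n → (a % n = 1 ↔ a = 1 ∨ a = n + 1) := by
    intro a ha
    rcases lt_or_ge a n with h | h
    · rw [Nat.mod_eq_of_lt h]; omega
    · rw [Nat.mod_eq_sub_mod h, Nat.mod_eq_of_lt (by omega)]; omega
  rw [mod_eq _ (by omega), mod_eq _ (by omega)]
  omega

theorem Walk.exists_dvd_of_cycleGraph {n : ℕ} (hn : 2 ≤ n) {v w : Fin n}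
    (p : (cycleGraph n).Walk v w) :
    ∃ z : ℤ, |z| ≤ p.length ∧ (n : ℤ) ∣ (w : ℤ) - v - z := by
  induction p with
  | nil => exact ⟨0, by simp, by simp⟩
  | cons h p ih =>
    obtain ⟨z, hz, hd⟩ := ih
    rw [Walk.length_cons]
    rcases (cycleGraph_adj_iff_dvd hn _ _).1 h with h | h
    · refine ⟨z + 1, by rw [abs_le] at *; omega, ?_⟩
      convert Int.dvd_add hd h using 1
      ring
    · refine ⟨z - 1, by rw [abs_le] at *; omega, ?_⟩
      convert Int.dvd_add hd h using 1
      ring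

theorem cycleGraph_exists_walk_of_dvd {n : ℕ} (hn : 2 ≤ n) (k : ℕ) (v w : Fin n) (z : ℤ)
    (hz : |z| = k) (hd : (n : ℤ) ∣ (w : ℤ) - v - z) :
    ∃ p : (cycleGraph n).Walk v w, p.length = k := by
  induction k generalizing v z with
  | zero =>
    have h₀ : z = 0 := by simpa using hz
    subst h₀
    have : v = w := by
      have := Int.eq_zero_of_abs_lt_dvd hd (by rw [abs_lt]; omega)
      omega
    subst this
    exact ⟨.nil, rfl⟩
  | succ k ih =>
    obtain ⟨e, he, hze⟩ : ∃ e : ℤ, (e = 1 ∨ e = -1) ∧ |z - e| = k := by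
      rcases abs_cases z with h | h
      · exact ⟨1, .inl rfl, by rw [abs_of_nonneg] <;> omega⟩
      · exact ⟨-1, .inr rfl, by rw [abs_of_nonpos] <;> omega⟩
    have hn₀ : (n : ℤ) ≠ 0 := by omega
    have hnonneg := Int.emod_nonneg ((v : ℤ) + e) hn₀
    have hlt := Int.emod_lt_of_pos ((v : ℤ) + e) (b := n) (by omega)
    obtain ⟨x, hx⟩ : ∃ x : Fin n, (x : ℤ) = (v + e) % n :=
      ⟨⟨(((v : ℤ) + e) % n).toNat, by omega⟩, by simp [hnonneg]⟩
    have hxd : (n : ℤ) ∣ (x : ℤ) - (v + e) := by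
      rw [hx]; exact (Int.mod_modEq _ _).symm.dvd
    have hadj : (cycleGraph n).Adj v x := by
      rw [cycleGraph_adj_iff_dvd hn]
      rcases he with rfl | rfl
      · left; convert hxd using 1; ring
      · right; convert hxd using 1; ring
    obtain ⟨p, hp⟩ := ih x (z - e) hze (by convert Int.dvd_sub hd hxd using 1; ring)
    exact ⟨.cons hadj p, by simp [hp]⟩

theorem cycleGraph_dist_le_iff {n : ℕ} (hn : 2 ≤ n) (v w : Fin n) (r : ℕ) :
    (cycleGraph n).dist v w ≤ r ↔ ∃ z : ℤ, |z| ≤ r ∧ (n : ℤ) ∣ (w : ℤ) - v - z := by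
  constructor
  · intro h
    obtain ⟨p, hp⟩ := (cycleGraph_preconnected v w).exists_walk_length_eq_dist
    obtain ⟨z, hz, hd⟩ := p.exists_dvd_of_cycleGraph hn
    exact ⟨z, by omega, hd⟩
  · rintro ⟨z, hz, hd⟩
    obtain ⟨p, hp⟩ := cycleGraph_exists_walk_of_dvd hn z.natAbs v w z (by simp) hd
    have := dist_le p
    rw [Int.abs_eq_natAbs] at hz
    omega

/-- A ball of radius `r` in a cycle on at least `2 * r + 2` vertices induces a path. -/
theorem nonempty_pathGraph_iso_induce_cycleGraph_ball {n r : ℕ} (hn : 2 * r + 2 ≤ n)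
    (v : Fin n) :
    Nonempty (pathGraph (2 * r + 1) ≃g
      (cycleGraph n).induce {w | (cycleGraph n).dist v w ≤ r}) := by
  have hn₂ : 2 ≤ n := by omega
  have hdvd (i : ℕ) : (n : ℤ) ∣ (((v + (n - r) + i) % n : ℕ) : ℤ) - v - (i - r) := by
    have h := (Int.mod_modEq ((v : ℤ) + (n - r) + i) n).symm.dvd
    push_cast [Nat.cast_sub (show r ≤ n by omega)]
    convert Int.dvd_add h (Int.dvd_refl (n : ℤ)) using 1
    ring
  let f (i : Fin (2 * r + 1)) : {w : Fin n | (cycleGraph n).dist v w ≤ r} :=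
    ⟨⟨(v + (n - r) + i) % n, Nat.mod_lt _ (by omega)⟩,
      (cycleGraph_dist_le_iff hn₂ _ _ _).2 ⟨i - r, by rw [abs_le]; omega, hdvd i⟩⟩
  have hf (i : Fin (2 * r + 1)) : (n : ℤ) ∣ ((f i : Fin n) : ℤ) - v - (i - r) := hdvd i
  have hinj : Function.Injective f := by
    intro i j hij
    have h := Int.dvd_sub (hf j) (hf i)
    rw [hij] at h
    have := Int.eq_zero_of_abs_lt_dvd h (by rw [abs_lt]; omega)
    omega
  have hsurj : Function.Surjective f := by
    rintro ⟨w, hw⟩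
    obtain ⟨z, hz, hd⟩ := (cycleGraph_dist_le_iff hn₂ _ _ _).1 hw
    rw [abs_le] at hz
    obtain ⟨k, hk⟩ : ∃ k : Fin (2 * r + 1), (k : ℤ) = z + r :=
      ⟨⟨(z + r).toNat, by omega⟩, Int.toNat_of_nonneg (by omega)⟩
    have h := Int.eq_zero_of_abs_lt_dvd (Int.dvd_sub (hf k) hd) (by rw [abs_lt]; omega)
    refine ⟨k, Subtype.ext (Fin.ext ?_)⟩
    change ((f k : Fin n) : ℕ) = (w : ℕ)
    omega
  refine ⟨⟨Equiv.ofBijective f ⟨hinj, hsurj⟩, ?_⟩⟩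
  intro i j
  have hij := Int.dvd_sub (hf j) (hf i)
  have key (c : ℤ) (hc : |c| = 1) :
      (n : ℤ) ∣ ((f j : Fin n) : ℤ) - (f i : Fin n) - c ↔ (j : ℤ) - i = c := by
    constructor
    · intro h
      have := Int.eq_zero_of_abs_lt_dvd (Int.dvd_sub h hij)
        (by rw [abs_lt]; rcases abs_cases c with h | h <;> omega)
      omega
    · rintro rfl
      convert hij using 1
      ring
  have h₁ := key 1 (by simp)
  have h₂ := key (-1) (by simp)
  rw [sub_neg_eq_add] at h₂
  rw [comap_adj, pathGraph_adj]
  refine (cycleGraph_adj_iff_dvd hn₂ _ _).trans ((or_congr h₁ h₂).trans ?_)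
  omega

end SimpleGraph


/-- Large cycles of different sizes are locally indistinguishable: the radius-`r` balls
around any vertices of cycles on `n, m ≥ 2r + 2` vertices induce isomorphic subgraphs. -/
theorem cycles_locally_indistinguishable (n m r : ℕ)
    (hn : 2 * r + 2 ≤ n) (hm : 2 * r + 2 ≤ m) (v : Fin n) (u : Fin m) :
    Nonempty
      (SimpleGraph.induce {w : Fin n | (SimpleGraph.cycleGraph n).dist v w ≤ r}
          (SimpleGraph.cycleGraph n) ≃g
        SimpleGraph.induce {w : Fin m | (SimpleGraph.cycleGraph m).dist u w ≤ r}
          (SimpleGraph.cycleGraph m)) := by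
  obtain ⟨e⟩ := SimpleGraph.nonempty_pathGraph_iso_induce_cycleGraph_ball hn v
  obtain ⟨e'⟩ := SimpleGraph.nonempty_pathGraph_iso_induce_cycleGraph_ball hm u
  exact ⟨e.symm.trans e'⟩
end
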